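/- arXiv:1612.01440 — 3 statements merged into one kernel-verified Lean document; each statement's English description precedes it below -/
import Mathlib

section
/- Let D be a squarefree positive integer with ω(D) ≥ 4 such that ∏_{p | D} (p−1)/2 > 49, the product running over the prime divisors of D. Then φ(D) − 7·2^{ω(D)} ≥ 6·√D. -/
theorem totient_eq_prod_primeFactors_sub_one {n : ℕ} (hn : Squarefree n) :
    n.totient = ∏ p ∈ n.primeFactors, (p - 1) := by
  have h := Nat.totient_mul_prod_primeFactors n
  rw [Nat.prod_primeFactors_of_squarefree hn, mul_comm] at h
  exact Nat.eq_of_mul_eq_mul_left (Nat.pos_of_ne_zero hn.ne_zero) h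

theorem le_two_pow_card_primeFactors_mul_totient {n : ℕ} (hn : Squarefree n) :
    n ≤ 2 ^ n.primeFactors.card * n.totient := by
  rw [totient_eq_prod_primeFactors_sub_one hn, ← Finset.prod_const, ← Finset.prod_mul_distrib]
  conv_lhs => rw [← Nat.prod_primeFactors_of_squarefree hn]
  refine Finset.prod_le_prod' fun p hp => ?_
  have := (Nat.prime_of_mem_primeFactors hp).two_le
  omega

theorem prod_primeFactors_sub_one_div_two {n : ℕ} (hn : Squarefree n) :
    ∏ p ∈ n.primeFactors, (((p : ℚ) - 1) / 2) = n.totient / 2 ^ n.primeFactors.card := by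
  rw [totient_eq_prod_primeFactors_sub_one hn, Finset.prod_div_distrib, Finset.prod_const,
    Nat.cast_prod]
  congr 1
  refine Finset.prod_congr rfl fun p hp => ?_
  rw [Nat.cast_pred (Nat.prime_of_mem_primeFactors hp).pos]

/-- if `D` is a squarefree positive integer with `ω(D) ≥ 4` and
`∏_{p|D} (p−1)/2 > 49`, then `φ(D) − 7·2^{ω(D)} ≥ 6√D`. -/
theorem stmt3 (D : ℕ) (hD : 0 < D) (hsq : Squarefree D)
    (hω : 4 ≤ D.primeFactors.card)
    (hβ : (49 : ℚ) < ∏ p ∈ D.primeFactors, (((p : ℚ) - 1) / 2)) :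
    6 * Real.sqrt D ≤ (D.totient : ℝ) - 7 * 2 ^ D.primeFactors.card := by
  rw [prod_primeFactors_sub_one_div_two hsq, lt_div_iff₀ (by positivity)] at hβ
  have hφ : (49 : ℝ) * 2 ^ D.primeFactors.card < D.totient := by exact_mod_cast hβ
  have hle : (D : ℝ) ≤ 2 ^ D.primeFactors.card * D.totient := by
    exact_mod_cast le_two_pow_card_primeFactors_mul_totient hsq
  have hsqrt : Real.sqrt D ≤ D.totient / 7 := by
    refine Real.sqrt_le_iff.mpr ⟨by positivity, ?_⟩
    have := mul_le_mul_of_nonneg_right hφ.le (Nat.cast_nonneg (α := ℝ) D.totient)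
    nlinarith
  linarith
end

section
/- Let q_1, …, q_r be finitely many distinct odd primes. Then there are infinitely many primes ℓ such that ℓ ≡ 3 (mod 8) and the Legendre symbol (−ℓ/q_i) equals −1 for every i ∈ {1, …, r}. -/
theorem jacobiSym_neg_congr {a b q : ℕ} (h : a ≡ b [MOD q]) :
    jacobiSym (-(a : ℤ)) q = jacobiSym (-(b : ℤ)) q :=
  jacobiSym.mod_left' (Int.ModEq.neg (Int.natCast_modEq_iff.mpr h))

theorem exists_jacobiSym_neg_eq_neg_one {q : ℕ} (hq : q.Prime) (hodd : Odd q) :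
    ∃ b : ℕ, jacobiSym (-(b : ℤ)) q = -1 := by
  have : Fact q.Prime := ⟨hq⟩
  obtain ⟨x, hx⟩ := FiniteField.exists_nonsquare (F := ZMod q) (by
    rw [ZMod.ringChar_zmod_n]
    rintro rfl
    exact absurd hodd (by decide))
  refine ⟨(-x).val, ?_⟩
  rw [← jacobiSym.legendreSym.to_jacobiSym, legendreSym.eq_neg_one_iff]
  simpa using hx

theorem exists_mod_eight_eq_three_and_jacobiSym_neg (s : Finset ℕ)
    (hs : ∀ q ∈ s, q.Prime ∧ Odd q) :
    ∃ a : ℕ, a % 8 = 3 ∧ ∀ q ∈ s, jacobiSym (-(a : ℤ)) q = -1 := by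
  induction s using Finset.induction_on with
  | empty => exact ⟨3, by simp⟩
  | insert q s hqs ih =>
    obtain ⟨a, ha, has⟩ := ih fun p hp => hs p (Finset.mem_insert_of_mem hp)
    obtain ⟨hq, hodd⟩ := hs q (Finset.mem_insert_self q s)
    obtain ⟨b, hb⟩ := exists_jacobiSym_neg_eq_neg_one hq hodd
    have hcop : Nat.Coprime (8 * ∏ p ∈ s, p) q := by
      refine Nat.Coprime.mul_left ?_ (Nat.Coprime.prod_left fun p hp => ?_)
      · exact Nat.Coprime.pow_left 3 (Nat.coprime_two_left.mpr hodd)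
      · refine (Nat.coprime_primes (hs p (Finset.mem_insert_of_mem hp)).1 hq).mpr ?_
        rintro rfl
        exact hqs hp
    obtain ⟨c, hca, hcb⟩ := Nat.chineseRemainder hcop a b
    refine ⟨c, Eq.trans (hca.of_dvd (Dvd.intro _ rfl)) ha, fun p hp => ?_⟩
    rcases Finset.mem_insert.mp hp with rfl | hp
    · rw [jacobiSym_neg_congr hcb, hb]
    · rw [jacobiSym_neg_congr (hca.of_dvd ((Finset.dvd_prod_of_mem _ hp).mul_left 8)), has p hp]

/-- given finitely many distinct odd primes `q ∈ s`, there are infinitely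
many primes `ℓ` with `ℓ ≡ 3 (mod 8)` such that the Legendre symbol `(−ℓ/q)` equals `−1`
for every `q ∈ s`. -/
theorem stmt8 (s : Finset ℕ) (hs : ∀ q ∈ s, q.Prime ∧ Odd q) :
    {ℓ : ℕ | ℓ.Prime ∧ ℓ % 8 = 3 ∧
      ∀ q ∈ s, jacobiSym (-(ℓ : ℤ)) q = -1}.Infinite := by
  obtain ⟨a, ha, has⟩ := exists_mod_eight_eq_three_and_jacobiSym_neg s hs
  have hne : 8 * ∏ p ∈ s, p ≠ 0 :=
    mul_ne_zero (by norm_num) (Finset.prod_ne_zero_iff.mpr fun p hp => (hs p hp).1.ne_zero)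
  have hcop : a.Coprime (8 * ∏ p ∈ s, p) := by
    refine Nat.Coprime.mul_right ?_ (Nat.Coprime.prod_right fun p hp => ?_)
    · exact Nat.Coprime.pow_right 3 (Nat.coprime_two_right.mpr (Nat.odd_iff.mpr (by omega)))
    · have : NeZero p := ⟨(hs p hp).1.ne_zero⟩
      have h : jacobiSym (-(a : ℤ)) p ≠ 0 := by rw [has p hp]; decide
      simpa [Int.gcd_neg, Int.gcd_natCast_natCast] using mt jacobiSym.eq_zero_iff_not_coprime.mpr h
  refine (Nat.infinite_setOfPred_prime_and_modEq hne hcop).mono ?_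
  rintro ℓ ⟨hℓ, hmod⟩
  refine ⟨hℓ, Eq.trans (hmod.of_dvd (Dvd.intro _ rfl)) ha, fun p hp => ?_⟩
  rw [jacobiSym_neg_congr (hmod.of_dvd ((Finset.dvd_prod_of_mem _ hp).mul_left 8)), has p hp]
end

section
/- Let D > 1 be a squarefree integer with an even number of prime divisors. Let K be a number field of degree 2 over ℚ generated by an element α with α² = −D. Then the class number of K is even. -/
/-- Two integers `t`, `q` cannot satisfy `t² + p m q² = 4 p` when `p` is prime, `m > 1`, and
`p * m` is squarefree. -/
lemma sq_add_mul_sq_ne_four_mul {p m : ℕ} (hp : p.Prime) (hm : 1 < m) (hsq : Squarefree (p * m))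
    (t q : ℤ) : t ^ 2 + (p * m : ℕ) * q ^ 2 ≠ 4 * p := by
  intro h
  have hp2 := hp.two_le
  push_cast at h
  have hpt : (p : ℤ) ∣ t :=
    (Nat.prime_iff_prime_int.mp hp).dvd_of_dvd_pow (n := 2) ⟨4 - m * q ^ 2, by linear_combination h⟩
  obtain ⟨s, rfl⟩ := hpt
  have h4 : (p : ℤ) * s ^ 2 + m * q ^ 2 = 4 := by
    have hp0 : (p : ℤ) ≠ 0 := by exact_mod_cast hp.ne_zero
    apply mul_left_cancel₀ hp0
    linear_combination h
  have hs : s.natAbs ≤ 1 := by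
    by_contra! hs
    have hs' : 4 ≤ s ^ 2 := by
      rw [← Int.natAbs_sq]
      exact_mod_cast Nat.pow_le_pow_left hs 2
    nlinarith [sq_nonneg s, sq_nonneg q]
  have hq : q.natAbs ≤ 1 := by
    by_contra! hq
    have hq' : 4 ≤ q ^ 2 := by
      rw [← Int.natAbs_sq]
      exact_mod_cast Nat.pow_le_pow_left hq 2
    nlinarith [sq_nonneg s, sq_nonneg q]
  rw [← Int.natAbs_sq s, ← Int.natAbs_sq q] at h4
  have not_sq : ¬ Squarefree 4 := fun h ↦ by simpa using h 2 (by norm_num)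
  interval_cases s.natAbs <;> interval_cases q.natAbs <;> norm_num at h4
  · have : m = 4 := by exact_mod_cast h4
    exact not_sq (this ▸ hsq.of_mul_right)
  · have : p = 4 := by exact_mod_cast h4
    exact not_sq (this ▸ hsq.of_mul_left)
  · obtain ⟨rfl, rfl⟩ : p = 2 ∧ m = 2 := by omega
    exact not_sq hsq

/-- A rational number whose square becomes an integer after multiplication by a squarefree
natural number is an integer. -/
lemma exists_int_eq_of_squarefree_mul_sq {D : ℕ} (hsq : Squarefree D) {q : ℚ} {k : ℤ}
    (h : D * q ^ 2 = k) : ∃ z : ℤ, q = z := by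
  have hD : (D : ℚ) ≠ 0 := by exact_mod_cast hsq.ne_zero
  have hint : IsIntegral ℤ ((D : ℚ) * q) := by
    refine IsIntegral.of_pow (n := 2) two_pos ?_
    have : ((D : ℚ) * q) ^ 2 = ((D * k : ℤ) : ℚ) := by push_cast; rw [← h]; ring
    rw [this]
    exact isIntegral_algebraMap (R := ℤ) (A := ℚ) (x := (D * k : ℤ))
  obtain ⟨w, hw⟩ := IsIntegrallyClosed.isIntegral_iff.mp hint
  have hw : (w : ℚ) = D * q := hw
  have hdvd : (D : ℤ) ∣ w ^ 2 := by
    refine ⟨k, ?_⟩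
    have : (w : ℚ) ^ 2 = D * k := by rw [hw, ← h]; ring
    exact_mod_cast this
  have hsqZ : Squarefree (D : ℤ) := Int.squarefree_natCast.mpr hsq
  obtain ⟨z, rfl⟩ := (hsqZ.dvd_pow_iff_dvd two_ne_zero).mp hdvd
  refine ⟨z, mul_left_cancel₀ hD ?_⟩
  rw [← hw]
  push_cast
  ring

/-- A rational number that is integral when viewed in `ℂ` is an integer. -/
lemma exists_int_eq_of_isIntegral_ratCast {r : ℚ} (h : IsIntegral ℤ (r : ℂ)) :
    ∃ z : ℤ, r = z := by
  have h' : IsIntegral ℤ r :=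
    (isIntegral_algebraMap_iff (algebraMap ℚ ℂ).injective).mp (by simpa using h)
  obtain ⟨z, hz⟩ := IsIntegrallyClosed.isIntegral_iff.mp h'
  exact ⟨z, hz.symm⟩

section Quadratic

open NumberField

variable {K : Type*} [Field K] [NumberField K] {D : ℕ} {α : K}

lemma exists_eq_add_mul_of_adjoin_eq_top (hα : α ^ 2 = -(D : K))
    (hgen : IntermediateField.adjoin ℚ {α} = ⊤) (y : K) : ∃ r s : ℚ, y = r + s * α := by
  have hy : y ∈ Algebra.adjoin ℚ {α} := by
    rw [← IntermediateField.adjoin_simple_toSubalgebra_of_isAlgebraic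
      (Algebra.IsAlgebraic.isAlgebraic α), hgen]
    trivial
  induction hy using Algebra.adjoin_induction with
  | mem x hx => exact ⟨0, 1, by simp_all⟩
  | algebraMap r => exact ⟨r, 0, by simp⟩
  | add x y _ _ hx hy =>
    obtain ⟨a, b, rfl⟩ := hx
    obtain ⟨c, d, rfl⟩ := hy
    exact ⟨a + c, b + d, by push_cast; ring⟩
  | mul x y _ _ hx hy =>
    obtain ⟨a, b, rfl⟩ := hx
    obtain ⟨c, d, rfl⟩ := hy
    exact ⟨a * c - D * b * d, a * d + b * c, by push_cast; linear_combination b * d * hα⟩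

lemma conj_eq_neg_of_sq_eq_neg_natCast {a : ℂ} (ha : a ^ 2 = -(D : ℂ)) :
    starRingEnd ℂ a = -a := by
  have h : (starRingEnd ℂ a) ^ 2 = a ^ 2 := by rw [← map_pow, ha]; simp
  rcases sq_eq_sq_iff_eq_or_eq_neg.mp h with h | h
  · obtain ⟨r, rfl⟩ := Complex.conj_eq_iff_real.mp h
    have hr : r ^ 2 = -(D : ℝ) := by exact_mod_cast ha
    have : r = 0 := by nlinarith [sq_nonneg r, Nat.cast_nonneg (α := ℝ) D]
    simp [this]
  · exact h

/-- The squared absolute value and the coordinates of an algebraic integer of `ℚ(√-D)`. -/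
lemma exists_normSq_eq_natCast (hsq : Squarefree D) (hα : α ^ 2 = -(D : K))
    (hgen : IntermediateField.adjoin ℚ {α} = ⊤) (φ : K →+* ℂ) (y : 𝓞 K) :
    ∃ n : ℕ, Complex.normSq (φ y) = n ∧ ∃ t q : ℤ, t ^ 2 + D * q ^ 2 = 4 * n := by
  obtain ⟨r, s, hy⟩ := exists_eq_add_mul_of_adjoin_eq_top hα hgen (y : K)
  have hφα : (φ α) ^ 2 = -(D : ℂ) := by rw [← map_pow, hα]; simp
  have hφ : φ y = r + s * φ α := by rw [hy]; simp
  have hconj : starRingEnd ℂ (φ y) = r - s * φ α := by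
    rw [hφ]
    simp [conj_eq_neg_of_sq_eq_neg_natCast hφα, sub_eq_add_neg]
  have hint : IsIntegral ℤ (φ y) := map_isIntegral_int φ y.isIntegral_coe
  have hint' : IsIntegral ℤ (starRingEnd ℂ (φ y)) := map_isIntegral_int _ hint
  have hmul : φ y * starRingEnd ℂ (φ y) = ((r ^ 2 + D * s ^ 2 : ℚ) : ℂ) := by
    rw [hconj, hφ]
    push_cast
    linear_combination -(s : ℂ) ^ 2 * hφα
  have hadd : φ y + starRingEnd ℂ (φ y) = ((2 * r : ℚ) : ℂ) := by
    rw [hconj, hφ]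
    push_cast
    ring
  obtain ⟨t, ht⟩ := exists_int_eq_of_isIntegral_ratCast (hadd ▸ hint.add hint')
  obtain ⟨n, hn⟩ := exists_int_eq_of_isIntegral_ratCast (hmul ▸ hint.mul hint')
  have hn0 : 0 ≤ n := by
    have : (0 : ℚ) ≤ n := hn ▸ by positivity
    exact_mod_cast this
  lift n to ℕ using hn0
  have hk : D * (2 * s) ^ 2 = ((4 * n - t ^ 2 : ℤ) : ℚ) := by
    push_cast at hn ⊢
    rw [← ht, ← hn]
    ring
  obtain ⟨q, hq⟩ := exists_int_eq_of_squarefree_mul_sq hsq hk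
  refine ⟨n, ?_, t, q, ?_⟩
  · rw [Complex.mul_conj, hn] at hmul
    exact_mod_cast hmul
  · rw [hq] at hk
    have hk' : (D : ℤ) * q ^ 2 = 4 * n - t ^ 2 := by exact_mod_cast hk
    linarith

end Quadratic

/-- In a commutative ring where `a² = -p m` with `p`, `m` coprime, the ideal `(p, a)` squares
to `(p)`. -/
lemma span_pair_sq_eq_span_of_coprime {R : Type*} [CommRing R] {p m : ℕ} (hpm : p.Coprime m)
    {a : R} (ha : a ^ 2 = -((p * m : ℕ) : R)) :
    (Ideal.span {(p : R), a}) ^ 2 = Ideal.span {(p : R)} := by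
  rw [pow_two, Ideal.span_pair_mul_span_pair]
  push_cast at ha
  apply le_antisymm
  · rw [Ideal.span_le]
    rintro x (rfl | rfl | rfl | rfl) <;> rw [SetLike.mem_coe, Ideal.mem_span_singleton]
    · exact ⟨p, rfl⟩
    · exact ⟨a, rfl⟩
    · exact ⟨a, mul_comm _ _⟩
    · exact ⟨-m, by linear_combination ha⟩
  · rw [Ideal.span_singleton_le_iff_mem]
    obtain ⟨u, v, huv⟩ := Nat.isCoprime_iff_coprime.mpr hpm
    have huv' : (u : R) * p + v * m = 1 := by exact_mod_cast congrArg (Int.cast (R := R)) huv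
    have h : (p : R) = u * (p * p) - v * (a * a) := by
      linear_combination -(p : R) * huv' + (v : R) * ha
    refine (congrArg (· ∈ _) h).mpr ?_
    exact Ideal.sub_mem _ (Ideal.mul_mem_left _ _ (Ideal.subset_span (by simp)))
      (Ideal.mul_mem_left _ _ (Ideal.subset_span (by simp)))

/-- let `D > 1` be a squarefree integer with an even number of prime
divisors, and let `K` be a number field of degree 2 over `ℚ` generated by an element
`α` with `α² = −D` (so `K = ℚ(√−D)`).  Then the class number of `K` is even. -/
theorem stmt14 (D : ℕ) (hD : 1 < D) (hsq : Squarefree D)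
    (heven : Even D.primeFactors.card)
    (K : Type) [Field K] [NumberField K]
    (hdeg : Module.finrank ℚ K = 2)
    (α : K) (hα : α ^ 2 = -(D : K))
    (hgen : IntermediateField.adjoin ℚ {α} = ⊤) :
    Even (NumberField.classNumber K) := by
  obtain ⟨p, hp, m, hm⟩ := Nat.exists_prime_and_dvd hD.ne'
  have hm1 : 1 < m := by
    by_contra! hle
    have : m ≠ 0 := by rintro rfl; omega
    obtain rfl : m = 1 := by omega
    rw [hm, mul_one, hp.primeFactors, Finset.card_singleton] at heven
    exact absurd heven (by decide)
  have hpm : p.Coprime m := Nat.coprime_of_squarefree_mul (hm ▸ hsq)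
  have hαint : IsIntegral ℤ α := by
    refine IsIntegral.of_pow (n := 2) two_pos ?_
    rw [hα]
    exact (isIntegral_natCast D).neg
  let a : NumberField.RingOfIntegers K := ⟨α, hαint⟩
  have ha : a ^ 2 = -((p * m : ℕ) : NumberField.RingOfIntegers K) := by
    apply NumberField.RingOfIntegers.ext
    rw [← hm]
    change algebraMap _ K (a ^ 2) = algebraMap _ K (-(D : NumberField.RingOfIntegers K))
    rw [map_pow, map_neg, map_natCast]
    exact hα
  have hP := span_pair_sq_eq_span_of_coprime hpm ha
  set P : Ideal (NumberField.RingOfIntegers K) := Ideal.span {(p : NumberField.RingOfIntegers K), a}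
  have hp0 : (p : NumberField.RingOfIntegers K) ≠ 0 := by exact_mod_cast hp.ne_zero
  have hP0 : P ≠ ⊥ := by
    intro h
    rw [h, Ideal.bot_pow two_ne_zero, eq_comm, Ideal.span_singleton_eq_bot] at hP
    exact hp0 hP
  have hne : P ∈ nonZeroDivisors (Ideal (NumberField.RingOfIntegers K)) :=
    mem_nonZeroDivisors_of_ne_zero hP0
  have hone : ClassGroup.mk0 ⟨P, hne⟩ ≠ 1 := by
    intro h
    rw [ClassGroup.mk0_eq_one_iff] at h
    obtain ⟨x, hx⟩ := h.principal
    have hx : P = Ideal.span {x} := hx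
    rw [hx, Ideal.span_singleton_pow, Ideal.span_singleton_eq_span_singleton] at hP
    obtain ⟨φ⟩ : Nonempty (K →+* ℂ) := inferInstance
    obtain ⟨n, hn, t, q, htq⟩ := exists_normSq_eq_natCast hsq hα hgen φ x
    have hdvd : ∀ y z : NumberField.RingOfIntegers K, y ∣ z → ∀ k l : ℕ,
        Complex.normSq (φ y) = k → Complex.normSq (φ z) = l → k ∣ l := by
      rintro y _ ⟨w, rfl⟩ k l hk hl
      obtain ⟨j, hj, -⟩ := exists_normSq_eq_natCast hsq hα hgen φ w
      refine ⟨j, ?_⟩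
      simp only [map_mul, hk, hj] at hl
      exact_mod_cast hl.symm
    have hx2 : Complex.normSq (φ (x ^ 2 : NumberField.RingOfIntegers K)) = (n ^ 2 : ℕ) := by
      simp [hn]
    have hp2 : Complex.normSq (φ (p : NumberField.RingOfIntegers K)) = (p ^ 2 : ℕ) := by
      simp [pow_two]
    have hnp : n ^ 2 = p ^ 2 :=
      Nat.dvd_antisymm (hdvd _ _ hP.dvd _ _ hx2 hp2) (hdvd _ _ hP.symm.dvd _ _ hp2 hx2)
    obtain rfl : n = p := Nat.pow_left_injective two_ne_zero hnp
    rw [hm] at htq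
    exact sq_add_mul_sq_ne_four_mul hp hm1 (hm ▸ hsq) t q htq
  have hsq_one : ClassGroup.mk0 ⟨P, hne⟩ ^ 2 = 1 := by
    rw [← map_pow, SubmonoidClass.mk_pow, ClassGroup.mk0_eq_one_iff, hP]
    exact ⟨⟨_, rfl⟩⟩
  rw [even_iff_two_dvd, ← orderOf_eq_prime hsq_one hone]
  exact orderOf_dvd_card
end
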